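/- Let D be a Γ-invariant linear operator on compactly supported sections of finite propagation speed. Then for every z ∈ ℂ and all x, y ∈ Y, the heat kernel series Σ_{n≥0} (zⁿ/n!)⟨x|Dⁿ|y⟩ converges absolutely in End(V). -/

import Mathlib

open scoped BigOperators
open Filter

noncomputable section

variable {Y Γ V : Type*}

section Defs

variable [Group Γ] [MulAction Γ Y]
variable [NormedAddCommGroup V] [InnerProductSpace ℂ V]

/-- The action of `γ ∈ Γ` on compactly (= finitely) supported sections
`φ : Y →₀ V`, given by `(γ · φ)(y) = ρ(γ) φ(γ⁻¹ • y)`. -/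
def secAct (ρ : Γ →* (V ≃ₗᵢ[ℂ] V)) (γ : Γ) (φ : Y →₀ V) : Y →₀ V :=
  Finsupp.equivMapDomain (MulAction.toPerm γ) (φ.mapRange (ρ γ) ((ρ γ).map_zero))

/-- A linear operator on compactly supported sections is `Γ`-invariant if it
commutes with the action of `Γ`. -/
def IsEquivariantOp (ρ : Γ →* (V ≃ₗᵢ[ℂ] V)) (D : (Y →₀ V) →ₗ[ℂ] (Y →₀ V)) : Prop :=
  ∀ (γ : Γ) (φ : Y →₀ V), D (secAct ρ γ φ) = secAct ρ γ (D φ)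

/-- The kernel `⟨x|D|y⟩ ∈ End(V)` of an operator `D`, characterized by
`⟨x|D|y⟩ v = (D δ_{y,v})(x)`. -/
def kernelOf (D : (Y →₀ V) →ₗ[ℂ] (Y →₀ V)) (x y : Y) : V →ₗ[ℂ] V :=
  (Finsupp.lapply x) ∘ₗ D ∘ₗ (Finsupp.lsingle y)

/-- `D` has finite propagation speed `≤ R`:
`supp (Dφ) ⊆ U_R(supp φ) = {x | ∃ y ∈ supp φ, d(x,y) ≤ R}`. -/
def HasPropSpeed [MetricSpace Y] (D : (Y →₀ V) →ₗ[ℂ] (Y →₀ V)) (R : ℝ) : Prop :=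
  ∀ (φ : Y →₀ V) (x : Y), D φ x ≠ 0 → ∃ y ∈ φ.support, dist x y ≤ R

/-- A set of representatives of the orbits of a group `G` acting on `Y`:
it contains exactly one point of every orbit. -/
def IsRepSet (G : Type*) [Group G] [MulAction G Y] (S : Set Y) : Prop :=
  ∀ y : Y, ∃! s, s ∈ S ∧ s ∈ MulAction.orbit G y

/-- The space `W_{Γ'}` of `Γ'`-equivariant functions `f : Y → V`,
i.e. `f(γ • y) = ρ(γ) f(y)` for all `γ ∈ Γ'`. -/
def equivSubmodule (ρ : Γ →* (V ≃ₗᵢ[ℂ] V)) (Γ' : Subgroup Γ) : Submodule ℂ (Y → V) where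
  carrier := {f | ∀ (γ : Γ') (y : Y), f ((γ : Γ) • y) = ρ (γ : Γ) (f y)}
  add_mem' := by intro f g hf hg γ y; simp only [Pi.add_apply, hf γ y, hg γ y, map_add]
  zero_mem' := by intro γ y; simp
  smul_mem' := by intro c f hf γ y; simp only [Pi.smul_apply, hf γ y, map_smul]

/-- The summation map `S_{Γ'} φ (y) = Σ_{γ ∈ Γ'} ρ(γ)⁻¹ φ(γ • y)`. -/
def smap (ρ : Γ →* (V ≃ₗᵢ[ℂ] V)) (Γ' : Subgroup Γ) (φ : Y →₀ V) : Y → V :=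
  fun y => ∑ᶠ γ : Γ', ρ ((γ : Γ)⁻¹) (φ ((γ : Γ) • y))

/-- `DG` is the pushdown of `D` to `W_{Γ'}`, i.e. `DG ∘ S_{Γ'} = S_{Γ'} ∘ D`. -/
def IsPushdown (ρ : Γ →* (V ≃ₗᵢ[ℂ] V)) (Γ' : Subgroup Γ)
    (D : (Y →₀ V) →ₗ[ℂ] (Y →₀ V))
    (DG : equivSubmodule (Y := Y) ρ Γ' →ₗ[ℂ] equivSubmodule (Y := Y) ρ Γ') : Prop :=
  ∀ (w : equivSubmodule (Y := Y) ρ Γ') (φ : Y →₀ V),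
    (w : Y → V) = smap ρ Γ' φ → ((DG w : Y → V) = smap ρ Γ' (D φ))

/-- The kernel `⟨x|D|y⟩`, as a continuous linear map on `V`. -/
def kernelOfL [FiniteDimensional ℂ V] (D : (Y →₀ V) →ₗ[ℂ] (Y →₀ V)) (x y : Y) : V →L[ℂ] V :=
  LinearMap.toContinuousLinearMap (kernelOf D x y)

/-- The heat kernel `⟨x|e^{zD}|y⟩ = Σ_{n ≥ 0} (zⁿ/n!) ⟨x|Dⁿ|y⟩`. -/
def heatKer [FiniteDimensional ℂ V] (D : (Y →₀ V) →ₗ[ℂ] (Y →₀ V)) (z : ℂ) (x y : Y) :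
    V →L[ℂ] V :=
  ∑' n : ℕ, (z ^ n / (n.factorial : ℂ)) • kernelOfL (D ^ n) x y

/-- The `Γ`-trace `tr_Γ e^{zD} = Σ_{s ∈ S} tr ⟨s|e^{zD}|s⟩`,
for a set `S` of representatives of the `Γ`-orbits. -/
def trGammaHeat [FiniteDimensional ℂ V] (D : (Y →₀ V) →ₗ[ℂ] (Y →₀ V)) (z : ℂ)
    (S : Set Y) : ℂ :=
  ∑ᶠ s ∈ S, LinearMap.trace ℂ V ((heatKer D z s s : V →L[ℂ] V) : V →ₗ[ℂ] V)

/-- `tr e^{zT}` for an endomorphism `T` of a finite dimensional space,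
via the exponential series `Σ_{n ≥ 0} (zⁿ/n!) tr(Tⁿ)`. -/
def trExp {W : Type*} [AddCommGroup W] [Module ℂ W] (T : W →ₗ[ℂ] W) (z : ℂ) : ℂ :=
  ∑' n : ℕ, z ^ n / (n.factorial : ℂ) * LinearMap.trace ℂ W (T ^ n)

end Defs

section SumNorm

variable [NormedAddCommGroup V]

/-- The `ℓ¹`-norm of a finitely supported section. -/
def sumNorm (φ : Y →₀ V) : ℝ :=
  φ.sum fun _ v => ‖v‖

theorem sumNorm_eq_of_support_subset (φ : Y →₀ V) {s : Finset Y} (h : φ.support ⊆ s) :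
    sumNorm φ = ∑ x ∈ s, ‖φ x‖ :=
  Finsupp.sum_of_support_subset φ h _ fun _ _ => norm_zero

theorem sumNorm_zero : sumNorm (0 : Y →₀ V) = 0 :=
  Finsupp.sum_zero_index

theorem sumNorm_single (y : Y) (v : V) : sumNorm (Finsupp.single y v) = ‖v‖ :=
  Finsupp.sum_single_index norm_zero

theorem sumNorm_add_le (φ ψ : Y →₀ V) : sumNorm (φ + ψ) ≤ sumNorm φ + sumNorm ψ := by
  classical
  rw [sumNorm_eq_of_support_subset (φ + ψ) Finsupp.support_add,
    sumNorm_eq_of_support_subset φ Finset.subset_union_left,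
    sumNorm_eq_of_support_subset ψ Finset.subset_union_right, ← Finset.sum_add_distrib]
  exact Finset.sum_le_sum fun x _ => norm_add_le _ _

theorem sumNorm_sum_le {ι : Type*} (s : Finset ι) (φ : ι → Y →₀ V) :
    sumNorm (∑ i ∈ s, φ i) ≤ ∑ i ∈ s, sumNorm (φ i) := by
  classical
  induction s using Finset.induction_on with
  | empty => simp [sumNorm_zero]
  | insert i s hi ih =>
    rw [Finset.sum_insert hi, Finset.sum_insert hi]
    exact (sumNorm_add_le _ _).trans (by gcongr)

theorem norm_apply_le_sumNorm (φ : Y →₀ V) (x : Y) : ‖φ x‖ ≤ sumNorm φ := by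
  classical
  rw [sumNorm_eq_of_support_subset φ (Finset.subset_insert x φ.support)]
  exact Finset.single_le_sum (f := fun x => ‖φ x‖) (fun _ _ => norm_nonneg _)
    (Finset.mem_insert_self x _)

variable [InnerProductSpace ℂ V]

theorem sumNorm_secAct [Group Γ] [MulAction Γ Y] (ρ : Γ →* (V ≃ₗᵢ[ℂ] V)) (γ : Γ) (φ : Y →₀ V) :
    sumNorm (secAct ρ γ φ) = sumNorm φ := by
  unfold sumNorm secAct
  rw [Finsupp.sum_equivMapDomain, Finsupp.sum_mapRange_index fun _ => norm_zero]
  simp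

theorem secAct_single [Group Γ] [MulAction Γ Y] (ρ : Γ →* (V ≃ₗᵢ[ℂ] V)) (γ : Γ) (y : Y) (v : V) :
    secAct ρ γ (Finsupp.single y v) = Finsupp.single (γ • y) (ρ γ v) := by
  unfold secAct
  rw [Finsupp.mapRange_single, Finsupp.equivMapDomain_single, MulAction.toPerm_apply]

theorem sumNorm_map_le (D : (Y →₀ V) →ₗ[ℂ] (Y →₀ V)) {C : ℝ}
    (hC : ∀ y v, sumNorm (D (Finsupp.single y v)) ≤ C * ‖v‖) (φ : Y →₀ V) :
    sumNorm (D φ) ≤ C * sumNorm φ := by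
  calc sumNorm (D φ) = sumNorm (∑ y ∈ φ.support, D (Finsupp.single y (φ y))) := by
        conv_lhs => rw [← Finsupp.sum_single φ, Finsupp.sum, map_sum]
    _ ≤ ∑ y ∈ φ.support, sumNorm (D (Finsupp.single y (φ y))) :=
        sumNorm_sum_le _ _
    _ ≤ ∑ y ∈ φ.support, C * ‖φ y‖ := Finset.sum_le_sum fun y _ => hC y _
    _ = C * sumNorm φ := by rw [← Finset.mul_sum]; rfl

theorem sumNorm_pow_le (D : (Y →₀ V) →ₗ[ℂ] (Y →₀ V)) {C : ℝ} (hC₀ : 0 ≤ C)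
    (hC : ∀ φ, sumNorm (D φ) ≤ C * sumNorm φ) (n : ℕ) (φ : Y →₀ V) :
    sumNorm ((D ^ n) φ) ≤ C ^ n * sumNorm φ := by
  induction n with
  | zero => simp
  | succ n ih =>
    rw [pow_succ', Module.End.mul_apply, pow_succ', mul_assoc]
    exact (hC _).trans (mul_le_mul_of_nonneg_left ih hC₀)

theorem exists_sumNorm_map_single_le [FiniteDimensional ℂ V] (D : (Y →₀ V) →ₗ[ℂ] (Y →₀ V))
    (y : Y) {s : Set Y} (hs : s.Finite) (hD : ∀ v x, D (Finsupp.single y v) x ≠ 0 → x ∈ s) :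
    ∃ C : ℝ, 0 ≤ C ∧ ∀ v, sumNorm (D (Finsupp.single y v)) ≤ C * ‖v‖ := by
  refine ⟨∑ x ∈ hs.toFinset, ‖kernelOfL D x y‖, Finset.sum_nonneg fun _ _ => norm_nonneg _,
    fun v => ?_⟩
  rw [sumNorm_eq_of_support_subset (s := hs.toFinset) _
    fun x hx => hs.mem_toFinset.2 (hD v x (Finsupp.mem_support_iff.1 hx)), Finset.sum_mul]
  exact Finset.sum_le_sum fun x _ => (kernelOfL D x y).le_opNorm v

/-- An invariant operator of finite propagation speed on a proper cocompact space is bounded in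
the `ℓ¹`-norm. -/
theorem exists_sumNorm_map_le [MetricSpace Y] [Group Γ] [MulAction Γ Y] [FiniteDimensional ℂ V]
    (hball : ∀ (y : Y) (R : ℝ), (Metric.closedBall y R).Finite)
    (horb : Finite (MulAction.orbitRel.Quotient Γ Y))
    {ρ : Γ →* (V ≃ₗᵢ[ℂ] V)} {D : (Y →₀ V) →ₗ[ℂ] (Y →₀ V)} (hinv : IsEquivariantOp ρ D)
    {R : ℝ} (hprop : HasPropSpeed D R) :
    ∃ C : ℝ, 0 ≤ C ∧ ∀ φ, sumNorm (D φ) ≤ C * sumNorm φ := by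
  have hloc (y : Y) := exists_sumNorm_map_single_le D y (hball y R) fun v x hx => by
    obtain ⟨w, hw, hxw⟩ := hprop _ x hx
    obtain rfl := Finset.mem_singleton.1 (Finsupp.support_single_subset hw)
    exact hxw
  choose C hC₀ hC using hloc
  have := Fintype.ofFinite (MulAction.orbitRel.Quotient Γ Y)
  refine ⟨∑ q : MulAction.orbitRel.Quotient Γ Y, C q.out, Finset.sum_nonneg fun q _ => hC₀ _,
    sumNorm_map_le D fun y v => ?_⟩
  obtain ⟨γ, hγ⟩ : ∃ γ : Γ, γ • (Quotient.mk (MulAction.orbitRel Γ Y) y).out = y :=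
    MulAction.orbitRel_apply.1 ((MulAction.orbitRel Γ Y).symm
      (Quotient.mk_out (s := MulAction.orbitRel Γ Y) y))
  set q : MulAction.orbitRel.Quotient Γ Y := Quotient.mk (MulAction.orbitRel Γ Y) y
  have hsingle : Finsupp.single y v = secAct ρ γ (Finsupp.single q.out ((ρ γ).symm v)) := by
    rw [secAct_single, LinearIsometryEquiv.apply_symm_apply]
    exact congrArg (Finsupp.single · v) hγ.symm
  rw [hsingle, hinv, sumNorm_secAct]
  refine (hC _ _).trans ?_
  rw [LinearIsometryEquiv.norm_map]
  exact mul_le_mul_of_nonneg_right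
    (Finset.single_le_sum (f := fun q : MulAction.orbitRel.Quotient Γ Y => C q.out)
      (fun q _ => hC₀ _) (Finset.mem_univ q)) (norm_nonneg v)

theorem norm_kernelOfL_pow_le [FiniteDimensional ℂ V] (D : (Y →₀ V) →ₗ[ℂ] (Y →₀ V)) {C : ℝ}
    (hC₀ : 0 ≤ C) (hC : ∀ φ, sumNorm (D φ) ≤ C * sumNorm φ) (n : ℕ) (x y : Y) :
    ‖kernelOfL (D ^ n) x y‖ ≤ C ^ n := by
  refine ContinuousLinearMap.opNorm_le_bound _ (pow_nonneg hC₀ n) fun v => ?_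
  calc ‖(D ^ n) (Finsupp.single y v) x‖ ≤ sumNorm ((D ^ n) (Finsupp.single y v)) :=
        norm_apply_le_sumNorm _ x
    _ ≤ C ^ n * sumNorm (Finsupp.single y v) := sumNorm_pow_le D hC₀ hC n _
    _ = C ^ n * ‖v‖ := by rw [sumNorm_single]

end SumNorm

/-- Let `D` be a `Γ`-invariant operator of finite propagation speed on compactly
supported sections.  Then for every `z ∈ ℂ` and all `x, y ∈ Y` the heat kernel
series `Σ_{n≥0} (zⁿ/n!) ⟨x|Dⁿ|y⟩` converges absolutely in `End(V)`. -/
theorem heat_kernel_summable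
    [MetricSpace Y] [Group Γ] [MulAction Γ Y]
    [NormedAddCommGroup V] [InnerProductSpace ℂ V] [FiniteDimensional ℂ V]
    (hball : ∀ (y : Y) (R : ℝ), (Metric.closedBall y R).Finite)
    (hiso : ∀ γ : Γ, Isometry (fun y : Y => γ • y))
    (hfree : ∀ (γ : Γ) (y : Y), γ • y = y → γ = 1)
    (horb : Finite (MulAction.orbitRel.Quotient Γ Y))
    (ρ : Γ →* (V ≃ₗᵢ[ℂ] V))
    (D : (Y →₀ V) →ₗ[ℂ] (Y →₀ V))
    (hinv : IsEquivariantOp ρ D)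
    (hprop : ∃ R : ℝ, HasPropSpeed D R) :
    ∀ (z : ℂ) (x y : Y),
      Summable (fun n : ℕ => ‖(z ^ n / (n.factorial : ℂ)) • kernelOfL (D ^ n) x y‖) := by
  obtain ⟨R, hR⟩ := hprop
  obtain ⟨C, hC₀, hC⟩ := exists_sumNorm_map_le hball horb hinv hR
  intro z x y
  refine Summable.of_nonneg_of_le (fun _ => norm_nonneg _) (fun n => ?_)
    (Real.summable_pow_div_factorial (‖z‖ * C))
  rw [norm_smul, norm_div, norm_pow, Complex.norm_natCast, mul_pow, mul_div_right_comm]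
  exact mul_le_mul_of_nonneg_left (norm_kernelOfL_pow_le D hC₀ hC n x y) (by positivity)
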